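/- arXiv:2108.01950 — 2 statements merged into one kernel-verified Lean document; each statement's English description precedes it below -/
import Mathlib

section
/- The determinant of the 3×3 matrix with columns B₀ − A₀, D₀ − A₀, C₁ − A₀ equals −(2rs − 1)(2Hrs + h)/(2s). Consequently, the four points A₀, B₀, D₀, C₁ are coplanar if and only if (2rs − 1)(2Hrs + h) = 0. -/
/-- Four points of Euclidean 3-space are coplanar iff the determinant of their difference
vectors from one of them vanishes. -/
theorem EuclideanSpace.coplanar_iff_det_sub_eq_zero (p a b d : EuclideanSpace ℝ (Fin 3)) :
    Coplanar ℝ ({p, a, b, d} : Set (EuclideanSpace ℝ (Fin 3))) ↔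
      (Matrix.of fun i j : Fin 3 => (![a - p, b - p, d - p] j) i).det = 0 := by
  have hspan : vectorSpan ℝ ({p, a, b, d} : Set (EuclideanSpace ℝ (Fin 3))) =
      Submodule.span ℝ (Set.range ![a - p, b - p, d - p]) := by
    rw [vectorSpan_eq_span_vsub_set_right ℝ (Set.mem_insert p _)]
    simp only [Set.image_insert_eq, Set.image_singleton, vsub_eq_sub, sub_self,
      Submodule.span_insert_zero]
    congr 1
    ext v
    simp
    tauto
  have hind : LinearIndependent ℝ ![a - p, b - p, d - p] ↔
      (Matrix.of fun i j : Fin 3 => (![a - p, b - p, d - p] j) i).det ≠ 0 := by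
    rw [← isUnit_iff_ne_zero, ← Matrix.isUnit_iff_isUnit_det,
      ← Matrix.linearIndependent_cols_iff_isUnit]
    exact (LinearMap.linearIndependent_iff (WithLp.linearEquiv 2 ℝ (Fin 3 → ℝ)).toLinearMap
      (LinearEquiv.ker _)).symm
  have hcard := linearIndependent_iff_card_le_finrank_span (R := ℝ) (b := ![a - p, b - p, d - p])
  rw [Fintype.card_fin, Set.finrank] at hcard
  rw [coplanar_iff_finrank_le_two, hspan, ← not_iff_not, ← ne_eq, ← hind, hcard]
  lia


/-- For the unit-cell of the generalized sandglass structure in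
ℝ³ with `A₀ = (R,0,H)`, `B₀ = (Rc,Rs,-H)`, `D₀ = (r,0,-h)`, `C₁ = (rc,rs,h)`,
where `c² + s² = 1`, `s > 0` and `R = 1/(2s)`, the determinant of the 3×3
matrix with columns `B₀ - A₀`, `D₀ - A₀`, `C₁ - A₀` equals
`-(2rs - 1)(2Hrs + h)/(2s)`. Consequently, the four points `A₀, B₀, D₀, C₁`
are coplanar if and only if `(2rs - 1)(2Hrs + h) = 0`. -/
theorem stmt_5 (c s R H h r : ℝ)
    (hcs : c^2 + s^2 = 1) (hs : 0 < s) (hR : R = 1/(2*s))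
    (A₀ B₀ D₀ C₁ : EuclideanSpace ℝ (Fin 3))
    (hA₀ : A₀ = ![R, 0, H]) (hB₀ : B₀ = ![R*c, R*s, -H])
    (hD₀ : D₀ = ![r, 0, -h]) (hC₁ : C₁ = ![r*c, r*s, h]) :
    (Matrix.of fun i j : Fin 3 => (![B₀ - A₀, D₀ - A₀, C₁ - A₀] j) i).det
        = -(2*r*s - 1) * (2*H*r*s + h) / (2*s) ∧
    (Coplanar ℝ ({A₀, B₀, D₀, C₁} : Set (EuclideanSpace ℝ (Fin 3))) ↔
        (2*r*s - 1) * (2*H*r*s + h) = 0) := by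
  have hdet : (Matrix.of fun i j : Fin 3 => (![B₀ - A₀, D₀ - A₀, C₁ - A₀] j) i).det
      = -(2*r*s - 1) * (2*H*r*s + h) / (2*s) := by
    simp only [Matrix.det_fin_three, Matrix.of_apply, Matrix.cons_val, PiLp.sub_apply,
      hA₀, hB₀, hD₀, hC₁, hR]
    field_simp
    ring
  refine ⟨hdet, ?_⟩
  rw [EuclideanSpace.coplanar_iff_det_sub_eq_zero, hdet, div_eq_zero_iff, neg_mul, neg_eq_zero]
  exact or_iff_left (by positivity)
end

section
/- For real numbers Q₁, Q₂, c with Q₁ = Q₂ =: Q and Q ≥ 1/4, the left-hand side of the extremal-snap condition E(c, Q₁, Q₂) := 4cQ₂Q₁ − 2cQ₂² − 2Q₁² − 28Q₂Q₁ − 2Q₂² + Q₁ + 5Q₂ − 2cQ₁² + (4Q₁ − 1)^{3/2}·√Q₂ + 8Q₂^{3/2}·√(4Q₁ − 1) + 4Q₁·√Q₂·√(4Q₁ − 1) is independent of c, namely E(c, Q, Q) = −32Q² + 6Q + (4Q − 1)^{3/2}·√Q + 12Q^{3/2}·√(4Q − 1), and this value is strictly negative; hence the extremal-snap condition E = 0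 has no solution with Q₁ = Q₂ ≥ 1/4. -/
/-- The left-hand side of the extremal-snap condition of the origami sandglass
structure, where `Q₁`, `Q₂` are the squared lengths of the belt edges `L₁`,
`L₂` and `c = cos(π/n)`; here `W := 4Q₁ - 1` and `W^(3/2)`, `Q₂^(3/2)` are
real powers. -/
noncomputable def extremalSnapLHS (c Q₁ Q₂ : ℝ) : ℝ :=
  4*c*Q₂*Q₁ - 2*c*Q₂^2 - 2*Q₁^2 - 28*Q₂*Q₁ - 2*Q₂^2 + Q₁ + 5*Q₂ - 2*c*Q₁^2
    + (4*Q₁ - 1) ^ ((3:ℝ)/2) * Real.sqrt Q₂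
    + 8 * Q₂ ^ ((3:ℝ)/2) * Real.sqrt (4*Q₁ - 1)
    + 4*Q₁ * Real.sqrt Q₂ * Real.sqrt (4*Q₁ - 1)

theorem rpow_three_halves_eq_mul_sqrt {x : ℝ} (hx : 0 ≤ x) :
    x ^ ((3:ℝ)/2) = x * Real.sqrt x := by
  rw [show (3:ℝ)/2 = 1 + 1/2 by norm_num, Real.rpow_add_of_nonneg hx (by norm_num) (by norm_num),
    Real.rpow_one, ← Real.sqrt_eq_rpow]

theorem extremalSnapLHS_self (c : ℝ) {Q : ℝ} (hQ : 0 ≤ Q) :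
    extremalSnapLHS c Q Q
      = -32*Q^2 + 6*Q + (4*Q - 1) ^ ((3:ℝ)/2) * Real.sqrt Q
        + 12 * Q ^ ((3:ℝ)/2) * Real.sqrt (4*Q - 1) := by
  rw [extremalSnapLHS, rpow_three_halves_eq_mul_sqrt hQ]
  ring

/-- The key identity is `Q (32Q - 6)² = (4Q - 1) (16Q - 1)² + 1`. -/
theorem extremalSnap_diagonal_neg {Q : ℝ} (hQ : 1/4 ≤ Q) :
    -32*Q^2 + 6*Q + (4*Q - 1) ^ ((3:ℝ)/2) * Real.sqrt Q
        + 12 * Q ^ ((3:ℝ)/2) * Real.sqrt (4*Q - 1) < 0 := by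
  have hQ0 : 0 < Q := by linarith
  have hW0 : 0 ≤ 4*Q - 1 := by linarith
  rw [rpow_three_halves_eq_mul_sqrt hQ0.le, rpow_three_halves_eq_mul_sqrt hW0]
  have hs := Real.sqrt_pos.2 hQ0
  have hs2 := Real.sq_sqrt hQ0.le
  have hw2 := Real.sq_sqrt hW0
  set s := Real.sqrt Q
  set w := Real.sqrt (4*Q - 1)
  have hlt : w * (16*Q - 1) < s * (32*Q - 6) := by
    refine lt_of_pow_lt_pow_left₀ 2 (mul_nonneg hs.le (by linarith)) ?_
    rw [mul_pow, mul_pow, hs2, hw2]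
    linarith
  have hfactor : -32*Q^2 + 6*Q + (4*Q - 1) * w * s + 12 * (Q * s) * w
      = s * (w * (16*Q - 1) - s * (32*Q - 6)) := by
    linear_combination (32*Q - 6) * hs2
  rw [hfactor]
  exact mul_neg_of_pos_of_neg hs (sub_neg.2 hlt)

/-- For real numbers `Q₁, Q₂, c` with `Q₁ = Q₂ =: Q` and
`Q ≥ 1/4`, the left-hand side `E(c, Q₁, Q₂)` of the extremal-snap condition is
independent of `c`, namely
`E(c, Q, Q) = -32Q² + 6Q + (4Q - 1)^(3/2)·√Q + 12·Q^(3/2)·√(4Q - 1)`,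
and this value is strictly negative; hence the extremal-snap condition `E = 0`
has no solution with `Q₁ = Q₂ ≥ 1/4`. -/
theorem stmt_8 (Q₁ Q₂ c Q : ℝ) (h1 : Q₁ = Q) (h2 : Q₂ = Q) (hQ : 1/4 ≤ Q) :
    extremalSnapLHS c Q₁ Q₂
      = -32*Q^2 + 6*Q + (4*Q - 1) ^ ((3:ℝ)/2) * Real.sqrt Q
        + 12 * Q ^ ((3:ℝ)/2) * Real.sqrt (4*Q - 1) ∧
    -32*Q^2 + 6*Q + (4*Q - 1) ^ ((3:ℝ)/2) * Real.sqrt Q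
        + 12 * Q ^ ((3:ℝ)/2) * Real.sqrt (4*Q - 1) < 0 ∧
    extremalSnapLHS c Q₁ Q₂ ≠ 0 := by
  subst h1 h2
  have heq := extremalSnapLHS_self c (by linarith : 0 ≤ Q₂)
  have hneg := extremalSnap_diagonal_neg hQ
  exact ⟨heq, hneg, heq ▸ hneg.ne⟩
end
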